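/- Let M₄ and B be the 16×16 integer matrices of the previous statement (M₄ generating the paper's lattice, B generating 4 times the Barnes–Wall lattice). Then the ℤ-span of the rows of M₄ is a proper subgroup of the ℤ-span of the rows of B of index 256; in particular det M₄ = 256 · det B (up to sign) and the ℤ-span of the rows of B is not contained in the ℤ-span of the rows of M₄. -/

import Mathlib

/-- The rows of the generator matrix `M₄` of (4 times) the lattice `Λ` of the paper. -/
def M4rows : Fin 16 → Fin 16 → ℤ :=
  ![![1,1,1,1,1,1,1,1,1,1,1,1,1,1,1,1],
    ![0,2,0,0,0,0,0,2,0,0,0,2,0,2,0,0],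
    ![0,0,2,0,0,0,0,2,0,0,0,2,0,0,2,0],
    ![0,0,0,2,0,0,0,2,0,0,0,2,0,0,0,2],
    ![0,0,0,0,2,0,0,2,0,0,0,0,0,2,2,0],
    ![0,0,0,0,0,2,0,2,0,0,0,0,0,2,0,2],
    ![0,0,0,0,0,0,2,2,0,0,0,0,0,0,2,2],
    ![0,0,0,0,0,0,0,4,0,0,0,0,0,0,0,0],
    ![0,0,0,0,0,0,0,0,2,0,0,2,0,2,2,0],
    ![0,0,0,0,0,0,0,0,0,2,0,2,0,2,0,2],
    ![0,0,0,0,0,0,0,0,0,0,2,2,0,0,2,2],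
    ![0,0,0,0,0,0,0,0,0,0,0,4,0,0,0,0],
    ![0,0,0,0,0,0,0,0,0,0,0,0,2,2,2,2],
    ![0,0,0,0,0,0,0,0,0,0,0,0,0,4,0,0],
    ![0,0,0,0,0,0,0,0,0,0,0,0,0,0,4,0],
    ![0,0,0,0,0,0,0,0,0,0,0,0,0,0,0,4]]

/-- The rows of the generator matrix of (4 times) the Barnes–Wall lattice. -/
def BWrows : Fin 16 → Fin 16 → ℤ :=
  ![![1,0,0,0,0,1,0,1,0,0,1,1,0,1,1,1],
    ![0,1,0,0,0,1,1,1,1,0,1,0,1,1,0,0],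
    ![0,0,1,0,0,0,1,1,1,1,0,1,0,1,1,0],
    ![0,0,0,1,0,1,0,0,1,1,0,1,1,1,0,1],
    ![0,0,0,0,1,0,1,0,0,1,1,0,1,1,1,1],
    ![0,0,0,0,0,2,0,0,0,0,0,0,0,0,0,2],
    ![0,0,0,0,0,0,2,0,0,0,0,0,0,0,0,2],
    ![0,0,0,0,0,0,0,2,0,0,0,0,0,0,0,2],
    ![0,0,0,0,0,0,0,0,2,0,0,0,0,0,0,2],
    ![0,0,0,0,0,0,0,0,0,2,0,0,0,0,0,2],
    ![0,0,0,0,0,0,0,0,0,0,2,0,0,0,0,2],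
    ![0,0,0,0,0,0,0,0,0,0,0,2,0,0,0,2],
    ![0,0,0,0,0,0,0,0,0,0,0,0,2,0,0,2],
    ![0,0,0,0,0,0,0,0,0,0,0,0,0,2,0,2],
    ![0,0,0,0,0,0,0,0,0,0,0,0,0,0,2,2],
    ![0,0,0,0,0,0,0,0,0,0,0,0,0,0,0,4]]

namespace Matrix

variable {n : Type*} [Fintype n]

theorem span_range_mul_le {R : Type*} [CommRing R] (C A : Matrix n n R) :
    Submodule.span R (Set.range (C * A)) ≤ Submodule.span R (Set.range A) := by
  rw [Submodule.span_le]
  rintro _ ⟨i, rfl⟩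
  have h : (C * A) i = ∑ k, C i k • A k := by
    ext j
    simp [mul_apply, Finset.sum_apply]
  rw [h]
  exact Submodule.sum_mem _ fun k _ ↦
    Submodule.smul_mem _ _ (Submodule.subset_span (Set.mem_range_self k))

/-- The row lattice of `C * A` has index `|det C|` in the row lattice of `A`. -/
theorem card_quotient_span_range_mul [DecidableEq n] {C A : Matrix n n ℤ}
    (hC : C.det ≠ 0) (hA : A.det ≠ 0) :
    Nat.card (Submodule.span ℤ (Set.range A) ⧸
      (Submodule.span ℤ (Set.range (C * A))).comap (Submodule.span ℤ (Set.range A)).subtype) =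
      C.det.natAbs := by
  have hCA : (C * A).det ≠ 0 := by
    rw [det_mul]
    exact mul_ne_zero hC hA
  let b : Module.Basis n ℤ (Submodule.span ℤ (Set.range A)) :=
    .span (linearIndependent_rows_of_det_ne_zero hA)
  let b' : Module.Basis n ℤ (Submodule.span ℤ (Set.range (C * A))) :=
    .span (linearIndependent_rows_of_det_ne_zero hCA)
  let bN := b'.map (Submodule.comapSubtypeEquivOfLe (span_range_mul_le C A)).symm
  have hfree : Module.Free ℤ (Submodule.span ℤ (Set.range A)) := .of_basis b
  have hfin : Module.Finite ℤ (Submodule.span ℤ (Set.range A)) := .of_basis b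
  rw [← Submodule.natAbs_det_basis_change b _ bN, ← det_transpose C, Module.Basis.det_apply]
  congr 2
  ext i j
  have hb (k : n) : (b k : n → ℤ) = A k :=
    congrArg Subtype.val (Module.Basis.span_apply (linearIndependent_rows_of_det_ne_zero hA) k)
  have hbN : ((bN j : Submodule.span ℤ (Set.range A)) : n → ℤ) = (C * A) j :=
    congrArg Subtype.val (Module.Basis.span_apply (linearIndependent_rows_of_det_ne_zero hCA) j)
  have h : (bN j : Submodule.span ℤ (Set.range A)) = ∑ k, C j k • b k := by
    ext l
    simp [hbN, hb, mul_apply, Finset.sum_apply]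
  rw [Module.Basis.toMatrix_apply, Function.comp_apply, h, b.repr_sum_self, transpose_apply]

end Matrix

/-- The coordinates of the rows of `M₄` with respect to the rows of `B`. -/
def M4coords : Fin 16 → Fin 16 → ℤ :=
  ![![1,1,1,1,1,-1,-1,-1,-1,-1,-1,-1,-1,-2,-1,5],
    ![0,2,0,0,0,-1,-1,0,-1,0,-1,1,-1,0,0,2],
    ![0,0,2,0,0,0,-1,0,-1,-1,0,0,0,-1,0,2],
    ![0,0,0,2,0,-1,0,1,-1,-1,0,0,-1,-1,0,2],
    ![0,0,0,0,2,0,-1,1,0,-1,-1,0,-1,0,0,1],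
    ![0,0,0,0,0,1,0,1,0,0,0,0,0,1,0,-1],
    ![0,0,0,0,0,0,1,1,0,0,0,0,0,0,1,-1],
    ![0,0,0,0,0,0,0,2,0,0,0,0,0,0,0,-1],
    ![0,0,0,0,0,0,0,0,1,0,0,1,0,1,1,-2],
    ![0,0,0,0,0,0,0,0,0,1,0,1,0,1,0,-1],
    ![0,0,0,0,0,0,0,0,0,0,1,1,0,0,1,-1],
    ![0,0,0,0,0,0,0,0,0,0,0,2,0,0,0,-1],
    ![0,0,0,0,0,0,0,0,0,0,0,0,1,1,1,-1],
    ![0,0,0,0,0,0,0,0,0,0,0,0,0,2,0,-1],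
    ![0,0,0,0,0,0,0,0,0,0,0,0,0,0,2,-1],
    ![0,0,0,0,0,0,0,0,0,0,0,0,0,0,0,1]]

theorem M4coords_mul_BWrows : Matrix.of M4coords * Matrix.of BWrows = Matrix.of M4rows := by
  decide +kernel

theorem det_M4coords : (Matrix.of M4coords).det = 256 := by
  have h : ∀ i j : Fin 16, j < i → M4coords i j = 0 := by decide +kernel
  rw [Matrix.det_of_isUpperTriangular (M := Matrix.of M4coords) fun i j hij ↦ h i j hij]
  decide +kernel

theorem det_BWrows : (Matrix.of BWrows).det = 4096 := by
  have h : ∀ i j : Fin 16, j < i → BWrows i j = 0 := by decide +kernel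
  rw [Matrix.det_of_isUpperTriangular (M := Matrix.of BWrows) fun i j hij ↦ h i j hij]
  decide +kernel

theorem stmt_7 :
    let LM : Submodule ℤ (Fin 16 → ℤ) := Submodule.span ℤ (Set.range M4rows)
    let LB : Submodule ℤ (Fin 16 → ℤ) := Submodule.span ℤ (Set.range BWrows)
    LM ≤ LB ∧ LM ≠ LB ∧ ¬ LB ≤ LM ∧
    Nat.card (↥LB ⧸ Submodule.comap LB.subtype LM) = 256 ∧
    ((Matrix.of M4rows).det = 256 * (Matrix.of BWrows).det ∨
      (Matrix.of M4rows).det = -(256 * (Matrix.of BWrows).det)) := by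
  intro LM LB
  have hcard : Nat.card (↥LB ⧸ Submodule.comap LB.subtype LM) = 256 := by
    have h := Matrix.card_quotient_span_range_mul (C := Matrix.of M4coords) (A := Matrix.of BWrows)
      (by rw [det_M4coords]; decide) (by rw [det_BWrows]; decide)
    rw [M4coords_mul_BWrows, det_M4coords] at h
    exact h
  have hle : LM ≤ LB := by
    have h := Matrix.span_range_mul_le (Matrix.of M4coords) (Matrix.of BWrows)
    rw [M4coords_mul_BWrows] at h
    exact h
  have hnle : ¬ LB ≤ LM := by
    intro h
    rw [Submodule.comap_subtype_eq_top.mpr h, Nat.card_unique] at hcard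
    norm_num at hcard
  refine ⟨hle, fun h ↦ hnle h.ge, hnle, hcard, Or.inl ?_⟩
  rw [← M4coords_mul_BWrows, Matrix.det_mul, det_M4coords]
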